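/- arXiv:2206.04493 — 4 statements merged into one kernel-verified Lean document; each statement's English description precedes it below -/
import Mathlib

section
/- Let (J,𝓑,π) be a probability space, and p, n and m positive integers. For 1≤k≤m let M_k ⊆ {1,…,n}, and suppose every index i∈{1,…,n} belongs to at most p of the sets M_k. Let f_k, f_{k,ℓ} : J^n → ℝ (1≤k≤m, ℓ∈ℕ) be measurable functions such that f_k and f_{k,ℓ} depend only on the coordinates in M_k, there is a constant C with ‖f_{k,ℓ}‖_{L^p(π^n)} ≤ C for all k and ℓ, and ‖f_{k,ℓ} − f_k‖_{L^p(π^n)} → 0 as ℓ→∞ for each k. Then ∫_{J^n} ∏_{k=1}^m f_{k,ℓ} dπ^n → ∫_{J^n} ∏_{k=1}^m f_k dπ^n as ℓ→∞ (all these integrals being well defined and finite). -/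
open MeasureTheory Filter
open scoped ENNReal NNReal

/-- A marginal of a function depending only on the coordinates in `M` also depends only on the
coordinates in `M`. -/
theorem DependsOn.lmarginal {δ : Type*} [DecidableEq δ] {X : δ → Type*}
    [∀ i, MeasurableSpace (X i)] (μ : ∀ i, Measure (X i)) {M : Set δ}
    {g : (∀ i, X i) → ℝ≥0∞} (hg : DependsOn g M) (s : Finset δ) :
    DependsOn (∫⋯∫⁻_s, g ∂μ) M := by
  intro x y hxy
  refine lintegral_congr fun z => hg fun i hi => ?_
  by_cases his : i ∈ s
  · simp [Function.updateFinset, his]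
  · simp [Function.updateFinset, his, hxy i hi]

/-- **Finner's inequality** for marginals of nonnegative functions. -/
theorem lmarginal_prod_rpow_le {δ ι : Type*} [DecidableEq δ] [Fintype ι] {X : δ → Type*}
    [∀ i, MeasurableSpace (X i)] (μ : ∀ i, Measure (X i)) [∀ i, IsProbabilityMeasure (μ i)]
    {p : ℕ} (hp : 1 ≤ p) {M : ι → Set δ} (hM : ∀ i, {k | i ∈ M k}.ncard ≤ p)
    {g : ι → (∀ i, X i) → ℝ≥0∞} (hg : ∀ k, Measurable (g k))
    (hdep : ∀ k, DependsOn (g k) (M k)) (s : Finset δ) (x : ∀ i, X i) :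
    (∫⋯∫⁻_s, (fun y => ∏ k, g k y ^ (p : ℝ)⁻¹) ∂μ) x
      ≤ ∏ k, (∫⋯∫⁻_s, g k ∂μ) x ^ (p : ℝ)⁻¹ := by
  classical
  have hp0 : (0 : ℝ) < p := by exact_mod_cast hp
  have hmeas : Measurable fun y => ∏ k, g k y ^ (p : ℝ)⁻¹ :=
    Finset.measurable_fun_prod _ fun k _ => (hg k).pow_const _
  induction s using Finset.induction generalizing x with
  | empty => simp
  | insert i s hi ih =>
    rw [lmarginal_insert _ hmeas hi]
    set A : Finset ι := Finset.univ.filter fun k => i ∈ M k with hA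
    set H : ι → (∀ i, X i) → ℝ≥0∞ := fun k => ∫⋯∫⁻_s, g k ∂μ with hH
    have hHmeas (k) : Measurable (H k) := (hg k).lmarginal μ
    have hins (k) : (∫⋯∫⁻_(insert i s), g k ∂μ) x = ∫⁻ t, H k (Function.update x i t) ∂μ i := by
      rw [lmarginal_insert _ (hg k) hi]
    have hupd (k) : Measurable fun t => H k (Function.update x i t) :=
      (hHmeas k).comp (measurable_update x)
    have hconst (k) (hk : k ∉ A) (t) : H k (Function.update x i t) = H k x := by
      refine (hdep k).lmarginal μ s fun j hj => ?_
      refine Function.update_of_ne ?_ _ _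
      rintro rfl
      exact hk (by simpa [hA] using hj)
    have hcard : (A.card : ℝ) ≤ p := by
      have h := hM i
      rw [Set.ncard_eq_toFinset_card'] at h
      have hAeq : A = {k | i ∈ M k}.toFinset := by ext k; simp [hA]
      rw [hAeq]
      exact_mod_cast h
    have hsum : (1 - A.card / p : ℝ) + ∑ _k ∈ A, (p : ℝ)⁻¹ = 1 := by
      simp [div_eq_mul_inv]
    have hholder := ENNReal.lintegral_mul_prod_norm_pow_le (μ := μ i) A (g := fun _ => 1)
      (f := fun k t => H k (Function.update x i t)) aemeasurable_const
      (fun k _ => (hupd k).aemeasurable) _ hsum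
      (sub_nonneg.2 ((div_le_one hp0).2 hcard)) fun _ _ => by positivity
    simp only [ENNReal.one_rpow, one_mul, lintegral_const, measure_univ] at hholder
    calc ∫⁻ t, (∫⋯∫⁻_s, (fun y => ∏ k, g k y ^ (p : ℝ)⁻¹) ∂μ) (Function.update x i t) ∂μ i
        ≤ ∫⁻ t, ∏ k, H k (Function.update x i t) ^ (p : ℝ)⁻¹ ∂μ i := lintegral_mono fun t => ih _
      _ = ∫⁻ t, (∏ k ∈ Aᶜ, H k x ^ (p : ℝ)⁻¹)
            * ∏ k ∈ A, H k (Function.update x i t) ^ (p : ℝ)⁻¹ ∂μ i := by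
          refine lintegral_congr fun t => ?_
          rw [← Finset.prod_compl_mul_prod A]
          congr 1
          exact Finset.prod_congr rfl fun k hk => by rw [hconst k (Finset.mem_compl.1 hk)]
      _ = (∏ k ∈ Aᶜ, H k x ^ (p : ℝ)⁻¹)
            * ∫⁻ t, ∏ k ∈ A, H k (Function.update x i t) ^ (p : ℝ)⁻¹ ∂μ i :=
          lintegral_const_mul _ (Finset.measurable_fun_prod _ fun k _ => (hupd k).pow_const _)
      _ ≤ (∏ k ∈ Aᶜ, H k x ^ (p : ℝ)⁻¹)
            * ∏ k ∈ A, (∫⁻ t, H k (Function.update x i t) ∂μ i) ^ (p : ℝ)⁻¹ := by gcongr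
      _ = ∏ k, (∫⋯∫⁻_(insert i s), g k ∂μ) x ^ (p : ℝ)⁻¹ := by
          rw [← Finset.prod_compl_mul_prod A]
          congr 1
          · refine Finset.prod_congr rfl fun k hk => ?_
            simp [hins, hconst k (Finset.mem_compl.1 hk)]
          · simp only [hins]

/-- **Finner's inequality**. -/
theorem lintegral_prod_enorm_le_prod_eLpNorm {δ ι : Type*} [Fintype δ] [Fintype ι]
    {X : δ → Type*} [∀ i, MeasurableSpace (X i)] (μ : ∀ i, Measure (X i))
    [∀ i, IsProbabilityMeasure (μ i)]
    {p : ℕ} (hp : 1 ≤ p) {M : ι → Set δ} (hM : ∀ i, {k | i ∈ M k}.ncard ≤ p)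
    {g : ι → (∀ i, X i) → ℝ} (hg : ∀ k, Measurable (g k))
    (hdep : ∀ k, DependsOn (g k) (M k)) :
    ∫⁻ x, ‖∏ k, g k x‖ₑ ∂Measure.pi μ ≤ ∏ k, eLpNorm (g k) p (Measure.pi μ) := by
  classical
  have hp0 : p ≠ 0 := by lia
  obtain ⟨x⟩ : Nonempty (∀ i, X i) := (Measure.pi μ).nonempty_of_neZero
  have h := lmarginal_prod_rpow_le μ hp hM (g := fun k y => ‖g k y‖ₑ ^ (p : ℝ))
    (fun k => (hg k).enorm.pow_const _)
    (fun k a b hab => by simp only [hdep k hab]) Finset.univ x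
  simp only [← lintegral_eq_lmarginal_univ] at h
  convert h using 2 with y k k
  · ext y
    simp only [← ENNReal.rpow_mul, mul_inv_cancel₀ (Nat.cast_ne_zero (R := ℝ).2 hp0),
      ENNReal.rpow_one]
    simp [enorm_eq_nnnorm, nnnorm_prod]
  · rw [eLpNorm_eq_lintegral_rpow_enorm_toReal (by simpa using hp0) (by simp)]
    simp

/-- A product of functions in `L^p`, each coordinate entering at most `p` of them, is integrable. -/
theorem integrable_prod_of_memLp_of_dependsOn {δ ι : Type*} [Fintype δ] [Fintype ι]
    {X : δ → Type*} [∀ i, MeasurableSpace (X i)] (μ : ∀ i, Measure (X i))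
    [∀ i, IsProbabilityMeasure (μ i)]
    {p : ℕ} (hp : 1 ≤ p) {M : ι → Set δ} (hM : ∀ i, {k | i ∈ M k}.ncard ≤ p)
    {g : ι → (∀ i, X i) → ℝ} (hg : ∀ k, Measurable (g k))
    (hdep : ∀ k, DependsOn (g k) (M k)) (hLp : ∀ k, MemLp (g k) p (Measure.pi μ)) :
    Integrable (fun x => ∏ k, g k x) (Measure.pi μ) :=
  ⟨(Finset.measurable_fun_prod _ fun k _ => hg k).aestronglyMeasurable,
    (lintegral_prod_enorm_le_prod_eLpNorm μ hp hM hg hdep).trans_lt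
      (ENNReal.prod_lt_top fun k _ => (hLp k).2)⟩

/-- **Convergence form of Finner's inequality.**
Let `(J, π)` be a probability space and `p, n, m` positive integers.  For `1 ≤ k ≤ m` let
`M k ⊆ Fin n` and suppose every coordinate `i` lies in at most `p` of the sets `M k`.  Let
`f k` and `F k l` be measurable functions on `J^n` depending only on the coordinates in `M k`,
with `‖F k l‖_{L^p} ≤ C` uniformly and `‖F k l − f k‖_{L^p} → 0` as `l → ∞` for each `k`.
Then all the product integrals are well defined and finite, and
`∫ ∏_k F k l dπ^n → ∫ ∏_k f k dπ^n`. -/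
theorem finner_convergence {J : Type*} [MeasurableSpace J]
    (π : Measure J) [IsProbabilityMeasure π]
    (p n m : ℕ) (hp : 1 ≤ p) (hn : 1 ≤ n) (hm : 1 ≤ m)
    (M : Fin m → Set (Fin n))
    (hM : ∀ i : Fin n, {k : Fin m | i ∈ M k}.ncard ≤ p)
    (f : Fin m → (Fin n → J) → ℝ) (F : Fin m → ℕ → (Fin n → J) → ℝ)
    (hfmeas : ∀ k, Measurable (f k)) (hFmeas : ∀ k l, Measurable (F k l))
    (hdep : ∀ k (x y : Fin n → J), (∀ i ∈ M k, x i = y i) → f k x = f k y)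
    (hdepF : ∀ k l (x y : Fin n → J), (∀ i ∈ M k, x i = y i) → F k l x = F k l y)
    (C : ℝ≥0∞) (hC : C ≠ ⊤)
    (hbd : ∀ k l, eLpNorm (F k l) p (Measure.pi fun _ : Fin n => π) ≤ C)
    (hconv : ∀ k, Tendsto (fun l => eLpNorm (F k l - f k) p (Measure.pi fun _ : Fin n => π))
      atTop (nhds 0)) :
    Integrable (fun x => ∏ k, f k x) (Measure.pi fun _ : Fin n => π) ∧
    (∀ l, Integrable (fun x => ∏ k, F k l x) (Measure.pi fun _ : Fin n => π)) ∧
    Tendsto (fun l => ∫ x, ∏ k, F k l x ∂(Measure.pi fun _ : Fin n => π)) atTop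
      (nhds (∫ x, ∏ k, f k x ∂(Measure.pi fun _ : Fin n => π))) := by
  set μ := Measure.pi fun _ : Fin n => π with hμ
  have hFLp (k l) : MemLp (F k l) p μ :=
    ⟨(hFmeas k l).aestronglyMeasurable, (hbd k l).trans_lt hC.lt_top⟩
  have hfLp (k) : MemLp (f k) p μ := by
    obtain ⟨l, hl⟩ := ((hconv k).eventually_lt_const zero_lt_one).exists
    have hdiff : MemLp (F k l - f k) p μ :=
      ⟨((hFmeas k l).sub (hfmeas k)).aestronglyMeasurable, hl.trans ENNReal.one_lt_top⟩
    simpa using (hFLp k l).sub hdiff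
  refine ⟨integrable_prod_of_memLp_of_dependsOn _ hp hM hfmeas (fun k x y => hdep k x y) hfLp,
    fun l => integrable_prod_of_memLp_of_dependsOn _ hp hM (fun k => hFmeas k l)
      (fun k x y => hdepF k l x y) fun k => hFLp k l, ?_⟩
  let h (t : Finset (Fin m)) (l : ℕ) (k : Fin m) : (Fin n → J) → ℝ :=
    if k ∈ t then f k else F k l - f k
  have hmeas (t l k) : Measurable (h t l k) := by
    by_cases hk : k ∈ t
    · simpa [h, hk] using hfmeas k
    · simpa [h, hk] using (hFmeas k l).sub (hfmeas k)
  have hdeph (t l k) : DependsOn (h t l k) (M k) := by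
    intro x y hxy
    by_cases hk : k ∈ t <;> simp [h, hk, hdep k x y hxy, hdepF k l x y hxy]
  have hLp (t l k) : MemLp (h t l k) p μ := by
    by_cases hk : k ∈ t
    · simpa [h, hk] using hfLp k
    · simpa [h, hk] using (hFLp k l).sub (hfLp k)
  have hexp (l) : ∫ x, ∏ k, F k l x ∂μ = ∑ t, ∫ x, ∏ k, h t l k x ∂μ := by
    rw [← integral_finsetSum _ fun t _ =>
      integrable_prod_of_memLp_of_dependsOn _ hp hM (hmeas t l) (hdeph t l) (hLp t l)]
    congr with x
    calc ∏ k, F k l x = ∏ k, (f k x + (F k l x - f k x)) := by simp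
      _ = ∑ t, ∏ k, h t l k x := by
        rw [Fintype.prod_add]
        refine Finset.sum_congr rfl fun t _ => ?_
        rw [← Finset.prod_mul_prod_compl t fun k => h t l k x]
        congr 1
        · exact Finset.prod_congr rfl fun k hk => by simp [h, hk]
        · exact Finset.prod_congr rfl fun k hk => by simp [h, Finset.mem_compl.1 hk]
  have hlim (t : Finset (Fin m)) : Tendsto (fun l => ∫ x, ∏ k, h t l k x ∂μ) atTop
      (nhds (if t = Finset.univ then ∫ x, ∏ k, f k x ∂μ else 0)) := by
    split_ifs with ht
    · simp [h, ht]
    obtain ⟨k₀, hk₀⟩ : ∃ k, k ∉ t := by simpa [Finset.eq_univ_iff_forall] using ht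
    have hprod : Tendsto (fun l => ∏ k, eLpNorm (h t l k) p μ) atTop
        (nhds (∏ k, if k ∈ t then eLpNorm (f k) p μ else 0)) := by
      refine ENNReal.tendsto_finsetProd_of_ne_top _ (fun k _ => ?_) fun k _ => ?_
      · by_cases hk : k ∈ t
        · simp [h, hk]
        · simpa [h, hk] using hconv k
      · split_ifs
        exacts [(hfLp k).2.ne, ENNReal.zero_ne_top]
    rw [Finset.prod_eq_zero (Finset.mem_univ k₀) (by simp [hk₀])] at hprod
    rw [tendsto_zero_iff_enorm_tendsto_zero]
    exact tendsto_of_tendsto_of_tendsto_of_le_of_le tendsto_const_nhds hprod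
      (fun _ => zero_le) fun l => (enorm_integral_le_lintegral_enorm _).trans
        (lintegral_prod_enorm_le_prod_eLpNorm _ hp hM (hmeas t l) (hdeph t l))
  simp only [hexp]
  simpa using tendsto_finsetSum Finset.univ fun t _ => hlim t
end

section
/- Let (J,𝓑,η) be a Markov space with kernel (P_x : x∈J). For a finite tree F=(V,E) and a search order (v_1,…,v_n) of V (an ordering in which each v_i with i≥2 has exactly one neighbour among v_1,…,v_{i−1}), define a probability measure on J^V as the law of the random map obtained by drawing the image of v_1 from π and, for i=2,…,n, drawing the image of v_i from P applied at the image of the unique earlier neighbour of v_i. Then this distribution on J^V is the same for every search order of V; equivalently, the recursive leaf-attachment definition of the tree measure η^F is independent of the chosen leaf. -/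
open MeasureTheory ProbabilityTheory Filter
open scoped ENNReal

attribute [local instance] Classical.propDecidable

variable {J : Type*} [MeasurableSpace J]

/-- The sequential construction of the law of a random homomorphism of a rooted tree on
`Fin n` (with parent map `par`, where `par i < i` for `i ≠ 0`) into a Markov space with
stationary distribution `π` and step kernel `P`: vertex `0` is drawn from `π` and each
subsequent vertex `i` is obtained by a Markov step of `P` from the image of `par i`. -/
noncomputable def treeMeasure (π : Measure J) (P : Kernel J J) :
    (n : ℕ) → (Fin n → Fin n) → Measure (Fin n → J)
  | 0, _ => Measure.dirac fun i : Fin 0 => i.elim0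
  | (n + 1), par =>
      ((treeMeasure π P n fun i => ⟨(par i.castSucc).1 % n, Nat.mod_lt _ i.pos⟩).compProd
        (if h : 0 < n then
          Kernel.comap P
            (fun x : Fin n → J => x ⟨(par (Fin.last n)).1 % n, Nat.mod_lt _ h⟩)
            (measurable_pi_apply _)
        else Kernel.const _ π)).map
        fun q => Fin.snoc q.1 q.2

/-- `(e, par)` is a *search order* of the graph `G`: an enumeration `e : Fin n ≃ V` of the
vertices such that every vertex other than the first one is adjacent to exactly one earlier
vertex, namely its parent `par`. -/
def IsSearchOrder {V : Type*} (G : SimpleGraph V) {n : ℕ} (e : Fin n ≃ V)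
    (par : Fin n → Fin n) : Prop :=
  (∀ i : Fin n, 0 < i.1 → (par i).1 < i.1) ∧
  (∀ i : Fin n, 0 < i.1 → G.Adj (e (par i)) (e i)) ∧
  (∀ i j : Fin n, j.1 < i.1 → G.Adj (e j) (e i) → j = par i)

/-- The law `η^F` on `J^V` of the random homomorphism of a tree on `V` enumerated by the
search order `(e, par)`. -/
noncomputable def treeLaw {V : Type*} (π : Measure J) (P : Kernel J J)
    {n : ℕ} (e : Fin n ≃ V) (par : Fin n → Fin n) : Measure (V → J) :=
  (treeMeasure π P n par).map fun x v => x (e.symm v)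

/-- The set of leaves of a graph: vertices with exactly one neighbour. -/
def leafSet {V : Type*} (G : SimpleGraph V) : Set V := {v | ∃! w, G.Adj v w}

/-- The marginal `σ^F` of the tree law on the leaves of the tree. -/
noncomputable def leafMarginal {V : Type*} (π : Measure J) (P : Kernel J J)
    (G : SimpleGraph V) {n : ℕ} (e : Fin n ≃ V) (par : Fin n → Fin n) :
    Measure (↥(leafSet G) → J) :=
  (treeLaw π P e par).map fun x (v : ↥(leafSet G)) => x v.1

/-- The tree `G` is *loose* in the Markov space with stationary distribution `π` and kernel
`P`: the marginal of `η^G` on the set of leaves is absolutely continuous with respect to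
`π^{L(G)}` (for any, equivalently every, search order). -/
def TreeLoose {V : Type*} [Fintype V] (π : Measure J) (P : Kernel J J)
    (G : SimpleGraph V) : Prop :=
  ∀ (n : ℕ) (e : Fin n ≃ V) (par : Fin n → Fin n), IsSearchOrder G e par →
    leafMarginal π P G e par ≪ Measure.pi fun _ : ↥(leafSet G) => π

section TreeElimination

variable {V : Type*}

/-- Absorb the function at the leaf `l` into the function at its neighbour `u`. -/
noncomputable def absorb (P : Kernel J J) (f : V → J → ℝ≥0∞) (l u : V) : V → J → ℝ≥0∞ :=
  fun v x => f v x * if v = u then ∫⁻ y, f l y ∂(P x) else 1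

/-- `c` is a value obtained from the vertex functions `f` on `S` by successively absorbing
leaves of the subgraph induced on `S` until one vertex remains, whose function is then
integrated with respect to `π`. -/
inductive EliminatesTo (G : SimpleGraph V) (π : Measure J) (P : Kernel J J) :
    Finset V → (V → J → ℝ≥0∞) → ℝ≥0∞ → Prop
  | singleton (S : Finset V) (v : V) (f : V → J → ℝ≥0∞) (hS : S = {v}) :
      EliminatesTo G π P S f (∫⁻ x, f v x ∂π)
  | attach (S : Finset V) (l u : V) (f : V → J → ℝ≥0∞) (c : ℝ≥0∞) (hl : l ∈ S) (hu : u ∈ S)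
      (hadj : G.Adj u l) (huniq : ∀ w ∈ S, G.Adj w l → w = u)
      (h : EliminatesTo G π P (S.erase l) (absorb P f l u) c) :
      EliminatesTo G π P S f c

theorem measurable_absorb (P : Kernel J J) {f : V → J → ℝ≥0∞} (hf : ∀ v, Measurable (f v))
    (l u v : V) : Measurable (absorb P f l u v) := by
  unfold absorb
  refine (hf v).mul ?_
  split_ifs
  · exact (hf l).lintegral_kernel
  · exact measurable_const

theorem absorb_comm (P : Kernel J J) (f : V → J → ℝ≥0∞) {l u l' u' : V} (h : l' ≠ u)
    (h' : l ≠ u') :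
    absorb P (absorb P f l u) l' u' = absorb P (absorb P f l' u') l u := by
  funext v x
  simp only [absorb, if_neg h, if_neg h', mul_one]
  exact mul_right_comm _ _ _

namespace EliminatesTo

variable {G : SimpleGraph V} {π : Measure J} {P : Kernel J J} {S : Finset V}
  {f : V → J → ℝ≥0∞} {c : ℝ≥0∞}

theorem exists_of_change_functions (h : EliminatesTo G π P S f c) (g : V → J → ℝ≥0∞) :
    ∃ d, EliminatesTo G π P S g d := by
  induction h generalizing g with
  | singleton S v f hS => exact ⟨_, .singleton S v g hS⟩
  | attach S l u f c hl hu hadj huniq h ih =>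
    obtain ⟨d, hd⟩ := ih (absorb P g l u)
    exact ⟨d, .attach S l u g d hl hu hadj huniq hd⟩

theorem eq_lintegral {v : V} (h : EliminatesTo G π P S f c) (hS : S = {v}) :
    c = ∫⁻ x, f v x ∂π := by
  subst hS
  cases h with
  | singleton _ w _ hS => rw [Finset.singleton_injective hS]
  | attach _ l u _ _ hl hu hadj huniq h =>
    rw [Finset.mem_singleton.1 hl, Finset.mem_singleton.1 hu] at hadj
    exact (G.loopless.irrefl _ hadj).elim

theorem exists_adj (h : EliminatesTo G π P S f c) {x : V} (hx : x ∈ S) (hS : S ≠ {x}) :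
    ∃ y ∈ S, G.Adj y x := by
  induction h with
  | singleton S v f h =>
    subst h
    rw [Finset.mem_singleton.1 hx] at hS
    exact (hS rfl).elim
  | attach S l u f c hl hu hadj huniq h ih =>
    by_cases hxl : x = l
    · exact ⟨u, hu, hxl ▸ hadj⟩
    by_cases hxu : x = u
    · exact ⟨l, hl, hxu ▸ hadj.symm⟩
    obtain ⟨y, hy, hyx⟩ := ih (Finset.mem_erase.2 ⟨hxl, hx⟩) fun h' =>
      hxu (Finset.mem_singleton.1 (h' ▸ Finset.mem_erase.2 ⟨hadj.ne, hu⟩)).symm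
    exact ⟨y, Finset.mem_of_mem_erase hy, hyx⟩

/-- If the neighbour `l'` of a leaf `l` is itself a leaf, there are no further vertices. -/
theorem erase_eq_singleton {l l' : V} (h : EliminatesTo G π P (S.erase l) f c) (hl : l ∈ S)
    (hl' : l' ∈ S) (hne : l' ≠ l) (huniq : ∀ w ∈ S, G.Adj w l' → w = l) :
    S.erase l = {l'} ∧ S.erase l' = {l} := by
  have h₁ : S.erase l = {l'} := by
    by_contra hS
    obtain ⟨y, hy, hadj⟩ := h.exists_adj (Finset.mem_erase.2 ⟨hne, hl'⟩) hS
    exact Finset.ne_of_mem_erase hy (huniq y (Finset.mem_of_mem_erase hy) hadj)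
  refine ⟨h₁, ?_⟩
  rw [← Finset.insert_erase hl, h₁]
  ext x
  simp only [Finset.mem_erase, Finset.mem_insert, Finset.mem_singleton]
  grind

theorem exists_erase_leaf (h : EliminatesTo G π P S f c) {l' u' : V} (hl' : l' ∈ S)
    (hu' : u' ∈ S) (hadj' : G.Adj u' l') (huniq' : ∀ w ∈ S, G.Adj w l' → w = u')
    (g : V → J → ℝ≥0∞) : ∃ d, EliminatesTo G π P (S.erase l') g d := by
  induction h generalizing g with
  | singleton S v f hS =>
    subst hS
    rw [Finset.mem_singleton.1 hl', Finset.mem_singleton.1 hu'] at hadj'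
    exact (G.loopless.irrefl _ hadj').elim
  | attach S l u f c hl hu hadj huniq h ih =>
    by_cases hll : l' = l
    · subst hll
      exact h.exists_of_change_functions g
    by_cases hul : u = l'
    · subst hul
      have := huniq' l hl hadj.symm
      subst this
      exact ⟨_, .singleton _ l g (h.erase_eq_singleton hl hl' hll huniq').2⟩
    have hul' : u' ≠ l := by
      rintro rfl
      exact hul (huniq l' hl' hadj'.symm).symm
    obtain ⟨d, hd⟩ := ih (Finset.mem_erase.2 ⟨hll, hl'⟩) (Finset.mem_erase.2 ⟨hul', hu'⟩)
      (fun w hw => huniq' w (Finset.mem_of_mem_erase hw)) (absorb P g l u)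
    rw [Finset.erase_right_comm] at hd
    exact ⟨d, .attach _ l u g d (Finset.mem_erase.2 ⟨Ne.symm hll, hl⟩)
      (Finset.mem_erase.2 ⟨hul, hu⟩) hadj
      (fun w hw => huniq w (Finset.mem_of_mem_erase hw)) hd⟩

/-- For a reversible kernel the value does not depend on the order of elimination. -/
theorem unique
    (hrev : ∀ a b : J → ℝ≥0∞, Measurable a → Measurable b →
      ∫⁻ x, a x * ∫⁻ y, b y ∂(P x) ∂π = ∫⁻ x, b x * ∫⁻ y, a y ∂(P x) ∂π)
    (hf : ∀ v, Measurable (f v)) {c' : ℝ≥0∞}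
    (h : EliminatesTo G π P S f c) (h' : EliminatesTo G π P S f c') : c = c' := by
  induction S using Finset.strongInduction generalizing f c c' with
  | H S ih =>
    have h₀ := h
    have h₀' := h'
    cases h with
    | singleton _ v _ hS => exact (h'.eq_lintegral hS).symm
    | attach _ l u _ _ hl hu hadj huniq h =>
    cases h' with
    | singleton _ v _ hS => exact h₀.eq_lintegral hS
    | attach _ l' u' _ _ hl' hu' hadj' huniq' h' =>
    by_cases hll : l' = l
    · subst hll
      rw [huniq u' hu' hadj'] at h'
      exact ih _ (Finset.erase_ssubset hl) (measurable_absorb P hf _ _) h h'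
    by_cases hul : u = l'
    · subst hul
      have := huniq' l hl hadj.symm
      subst this
      obtain ⟨hS, hS'⟩ := h.erase_eq_singleton hl hl' hll huniq'
      rw [h.eq_lintegral hS, h'.eq_lintegral hS']
      simpa [absorb] using hrev _ _ (hf u) (hf l)
    have hul' : u' ≠ l := by
      rintro rfl
      exact hul (huniq l' hl' hadj'.symm).symm
    obtain ⟨d, hd⟩ := h.exists_erase_leaf (Finset.mem_erase.2 ⟨hll, hl'⟩)
      (Finset.mem_erase.2 ⟨hul', hu'⟩) hadj'
      (fun w hw => huniq' w (Finset.mem_of_mem_erase hw))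
      (absorb P (absorb P f l u) l' u')
    have hcd : c = d := ih _ (Finset.erase_ssubset hl) (measurable_absorb P hf _ _) h
      (.attach _ l' u' _ d (Finset.mem_erase.2 ⟨hll, hl'⟩) (Finset.mem_erase.2 ⟨hul', hu'⟩)
        hadj' (fun w hw => huniq' w (Finset.mem_of_mem_erase hw)) hd)
    rw [absorb_comm P f (Ne.symm hul) (Ne.symm hul'), Finset.erase_right_comm] at hd
    have hcd' : c' = d := ih _ (Finset.erase_ssubset hl') (measurable_absorb P hf _ _) h'
      (.attach _ l u _ d (Finset.mem_erase.2 ⟨Ne.symm hll, hl⟩)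
        (Finset.mem_erase.2 ⟨hul, hu⟩)
        hadj (fun w hw => huniq w (Finset.mem_of_mem_erase hw)) hd)
    rw [hcd, hcd']

end EliminatesTo

theorem measurable_fin_snoc (n : ℕ) :
    Measurable fun q : (Fin n → J) × J => (Fin.snoc q.1 q.2 : Fin (n + 1) → J) := by
  rw [measurable_pi_iff]
  intro i
  induction i using Fin.lastCases with
  | last => simpa using measurable_snd
  | cast i =>
    simp only [Fin.snoc_castSucc]
    exact (measurable_pi_apply i).comp measurable_fst

instance isProbabilityMeasure_treeMeasure (π : Measure J) [IsProbabilityMeasure π]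
    (P : Kernel J J) [IsMarkovKernel P] (n : ℕ) (par : Fin n → Fin n) :
    IsProbabilityMeasure (treeMeasure π P n par) := by
  induction n with
  | zero => rw [treeMeasure]; infer_instance
  | succ n ih =>
    rw [treeMeasure]
    have := ih fun i => ⟨(par i.castSucc).1 % n, Nat.mod_lt _ i.pos⟩
    split_ifs <;>
      exact Measure.isProbabilityMeasure_map (measurable_fin_snoc n).aemeasurable

theorem lintegral_treeMeasure_one (π : Measure J) [IsProbabilityMeasure π]
    (P : Kernel J J) (par : Fin 1 → Fin 1) {g : (Fin 1 → J) → ℝ≥0∞} (hg : Measurable g) :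
    ∫⁻ x, g x ∂(treeMeasure π P 1 par) = ∫⁻ y, g (fun _ => y) ∂π := by
  have hg' : Measurable fun q : (Fin 0 → J) × J => g (Fin.snoc q.1 q.2) :=
    hg.comp (measurable_fin_snoc 0)
  rw [treeMeasure, lintegral_map hg (measurable_fin_snoc 0), dif_neg (lt_irrefl 0), treeMeasure,
    Measure.lintegral_compProd hg', lintegral_dirac' _ hg'.lintegral_kernel_prod_right']
  simp only [Kernel.const_apply]
  refine lintegral_congr fun y => congrArg g ?_
  funext i
  rw [Fin.fin_one_eq_zero i]
  exact Fin.snoc_last (n := 0) (α := fun _ => J) _ _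

theorem lintegral_treeMeasure_succ (π : Measure J) [IsProbabilityMeasure π]
    (P : Kernel J J) [IsMarkovKernel P] {n : ℕ} (hn : 0 < n) (par : Fin (n + 1) → Fin (n + 1))
    {g : (Fin (n + 1) → J) → ℝ≥0∞} (hg : Measurable g) :
    ∫⁻ x, g x ∂(treeMeasure π P (n + 1) par) =
      ∫⁻ x, ∫⁻ y, g (Fin.snoc x y) ∂(P (x ⟨(par (Fin.last n)).1 % n, Nat.mod_lt _ hn⟩))
        ∂(treeMeasure π P n fun i => ⟨(par i.castSucc).1 % n, Nat.mod_lt _ i.pos⟩) := by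
  have hg' : Measurable fun q : (Fin n → J) × J => g (Fin.snoc q.1 q.2) :=
    hg.comp (measurable_fin_snoc n)
  rw [treeMeasure, lintegral_map hg (measurable_fin_snoc n), dif_pos hn,
    Measure.lintegral_compProd hg']
  rfl

theorem eliminatesTo_treeMeasure (G : SimpleGraph V) (π : Measure J) [IsProbabilityMeasure π]
    (P : Kernel J J) [IsMarkovKernel P] {n : ℕ} (hn : 0 < n) (e : Fin n → V)
    (he : Function.Injective e) (par : Fin n → Fin n)
    (hlt : ∀ i : Fin n, 0 < i.1 → (par i).1 < i.1)
    (hadj : ∀ i : Fin n, 0 < i.1 → G.Adj (e (par i)) (e i))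
    (huniq : ∀ i j : Fin n, j.1 < i.1 → G.Adj (e j) (e i) → j = par i)
    {f : V → J → ℝ≥0∞} (hf : ∀ v, Measurable (f v)) :
    EliminatesTo G π P (Finset.univ.image e) f
      (∫⁻ x, ∏ i, f (e i) (x i) ∂(treeMeasure π P n par)) := by
  have hmeas {m : ℕ} (e : Fin m → V) :
      Measurable fun x : Fin m → J => ∏ i, f (e i) (x i) :=
    Finset.measurable_prod _ fun i _ => (hf (e i)).comp (measurable_pi_apply i)
  induction n, hn using Nat.le_induction generalizing f with
  | base =>
    rw [lintegral_treeMeasure_one π P par (hmeas e)]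
    simpa using EliminatesTo.singleton (G := G) (π := π) (P := P) _ (e 0) f
      (show Finset.univ.image e = {e 0} by simp)
  | succ n hn ih =>
    have hpos : 0 < (Fin.last n).1 := hn
    set p : Fin n := ⟨(par (Fin.last n)).1 % n, Nat.mod_lt _ hn⟩ with hp
    have hpar (i : Fin n) (hi : 0 < i.1) :
        (⟨(par i.castSucc).1 % n, Nat.mod_lt _ i.pos⟩ : Fin n).castSucc = par i.castSucc :=
      Fin.ext (Nat.mod_eq_of_lt ((hlt i.castSucc hi).trans i.2))
    have hplast : p.castSucc = par (Fin.last n) :=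
      Fin.ext (Nat.mod_eq_of_lt (hlt (Fin.last n) hpos))
    have herase : (Finset.univ.image e).erase (e (Fin.last n)) =
        Finset.univ.image fun i : Fin n => e i.castSucc := by
      ext v
      simp only [Finset.mem_erase, Finset.mem_image, Finset.mem_univ, true_and]
      constructor
      · rintro ⟨hv, i, rfl⟩
        induction i using Fin.lastCases with
        | last => exact (hv rfl).elim
        | cast i => exact ⟨i, rfl⟩
      · rintro ⟨i, rfl⟩
        exact ⟨fun h => (Fin.castSucc_lt_last i).ne (he h), _, rfl⟩
    refine .attach _ (e (Fin.last n)) (e p.castSucc) f _ (by simp) (by simp)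
      (hplast ▸ hadj _ hpos) ?_ ?_
    · intro w hw hwadj
      obtain ⟨i, -, rfl⟩ := Finset.mem_image.1 hw
      induction i using Fin.lastCases with
      | last => exact (G.loopless.irrefl _ hwadj).elim
      | cast i => rw [hplast, ← huniq (Fin.last n) i.castSucc i.2 hwadj]
    · have key := ih (fun i : Fin n => e i.castSucc)
        (he.comp (Fin.castSucc_injective n))
        (fun i => ⟨(par i.castSucc).1 % n, Nat.mod_lt _ i.pos⟩)
        (fun i hi => by
          have := hlt i.castSucc hi
          rw [← hpar i hi] at this
          exact this)
        (fun i hi => by rw [hpar i hi]; exact hadj i.castSucc hi)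
        (fun i j hji h => by
          refine Fin.castSucc_injective n ?_
          rw [hpar i (Nat.zero_lt_of_lt hji)]
          exact huniq i.castSucc j.castSucc hji h)
        (measurable_absorb P hf (e (Fin.last n)) (e p.castSucc))
        (fun e => Finset.measurable_prod _ fun i _ =>
          (measurable_absorb P hf _ _ (e i)).comp (measurable_pi_apply i))
      rw [herase]
      convert key using 1
      rw [lintegral_treeMeasure_succ π P hn par (hmeas e)]
      refine lintegral_congr fun x => ?_
      simp only [Fin.prod_univ_castSucc, Fin.snoc_castSucc, Fin.snoc_last]
      rw [lintegral_const_mul _ (hf _)]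
      simp only [absorb, Finset.prod_mul_distrib, he.eq_iff, (Fin.castSucc_injective n).eq_iff]
      simp [hp]

theorem measurable_reindex {n : ℕ} (e : Fin n ≃ V) :
    Measurable fun (x : Fin n → J) (v : V) => x (e.symm v) :=
  measurable_pi_lambda _ fun v => measurable_pi_apply (e.symm v)

theorem eliminatesTo_treeLaw [Fintype V] [Nonempty V] (G : SimpleGraph V) (π : Measure J)
    [IsProbabilityMeasure π] (P : Kernel J J) [IsMarkovKernel P] {n : ℕ} (e : Fin n ≃ V)
    (par : Fin n → Fin n) (h : IsSearchOrder G e par) {f : V → J → ℝ≥0∞}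
    (hf : ∀ v, Measurable (f v)) :
    EliminatesTo G π P Finset.univ f (∫⁻ x, ∏ v, f v (x v) ∂(treeLaw π P e par)) := by
  have hn : 0 < n := (e.symm (Classical.arbitrary V)).pos
  have key := eliminatesTo_treeMeasure G π P hn e e.injective par h.1 h.2.1 h.2.2 hf
  rw [Finset.image_univ_equiv] at key
  convert key using 1
  have hmeas : Measurable fun x : V → J => ∏ v, f v (x v) :=
    Finset.measurable_prod _ fun v _ => (hf v).comp (measurable_pi_apply v)
  rw [treeLaw, lintegral_map hmeas (measurable_reindex e)]
  refine lintegral_congr fun x => ?_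
  rw [← e.prod_comp]
  simp

theorem measure_pi_ext_of_lintegral_prod [Fintype V] {μ ν : Measure (V → J)} [IsFiniteMeasure μ]
    (h : ∀ f : V → J → ℝ≥0∞, (∀ v, Measurable (f v)) →
      ∫⁻ x, ∏ v, f v (x v) ∂μ = ∫⁻ x, ∏ v, f v (x v) ∂ν) : μ = ν := by
  refine ext_of_generate_finite _ generateFrom_pi.symm isPiSystem_pi ?_ ?_
  · rintro _ ⟨s, hs, rfl⟩
    have hs' (v : V) : MeasurableSet (s v) := hs v (Set.mem_univ v)
    have hind (x : V → J) : ∏ v, (s v).indicator (1 : J → ℝ≥0∞) (x v) =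
        (Set.univ.pi s).indicator 1 x := by
      by_cases hx : x ∈ Set.univ.pi s
      · rw [Set.indicator_of_mem hx]
        exact Finset.prod_eq_one fun v _ => Set.indicator_of_mem (hx v (Set.mem_univ v)) _
      · rw [Set.indicator_of_notMem hx]
        obtain ⟨v, hv⟩ : ∃ v, x v ∉ s v := by simpa using hx
        exact Finset.prod_eq_zero (Finset.mem_univ v) (Set.indicator_of_notMem hv _)
    have := h (fun v => (s v).indicator 1) fun v => measurable_one.indicator (hs' v)
    simpa only [hind, lintegral_indicator_one (MeasurableSet.univ_pi hs')] using this
  · simpa using h (fun _ _ => 1) fun _ => measurable_const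

theorem lintegral_mul_kernel_comm_of_symmetric (η : Measure (J × J)) [IsProbabilityMeasure η]
    (hsym : η.map Prod.swap = η) (P : Kernel J J) [IsMarkovKernel P]
    (hP : ∀ A B : Set J, MeasurableSet A → MeasurableSet B →
      η (A ×ˢ B) = ∫⁻ x in A, P x B ∂(η.map Prod.fst))
    {a b : J → ℝ≥0∞} (ha : Measurable a) (hb : Measurable b) :
    ∫⁻ x, a x * ∫⁻ y, b y ∂(P x) ∂(η.map Prod.fst) =
      ∫⁻ x, b x * ∫⁻ y, a y ∂(P x) ∂(η.map Prod.fst) := by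
  have : IsProbabilityMeasure (η.map Prod.fst) :=
    Measure.isProbabilityMeasure_map measurable_fst.aemeasurable
  have hη : η = (η.map Prod.fst).compProd P :=
    Measure.ext_prod fun {A B} hA hB => by
      rw [hP A B hA hB, Measure.compProd_apply_prod hA hB]
  have hmeas {a b : J → ℝ≥0∞} (ha : Measurable a) (hb : Measurable b) :
      Measurable fun q : J × J => a q.1 * b q.2 :=
    (ha.comp measurable_fst).mul (hb.comp measurable_snd)
  have hint {a b : J → ℝ≥0∞} (ha : Measurable a) (hb : Measurable b) :
      ∫⁻ x, a x * ∫⁻ y, b y ∂(P x) ∂(η.map Prod.fst) = ∫⁻ q, a q.1 * b q.2 ∂η := by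
    conv_rhs => rw [hη]
    rw [Measure.lintegral_compProd (hmeas ha hb)]
    exact lintegral_congr fun x => (lintegral_const_mul _ hb).symm
  rw [hint ha hb, hint hb ha]
  conv_lhs => rw [← hsym]
  rw [lintegral_map (hmeas ha hb) measurable_swap]
  simp only [Prod.fst_swap, Prod.snd_swap, mul_comm]

end TreeElimination

/-- **Theorem (independence of the search order).**
Let `(J, η)` be a symmetric Markov space with stationary distribution `π = η ∘ fst⁻¹` and
disintegrating Markov kernel `P`, and let `G` be a finite tree on `V`.  Then the law on
`J^V` of the random homomorphism of `G` obtained by the sequential construction is the same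
for every search order of `V`; equivalently, the recursive leaf-attachment definition of
`η^G` is independent of the chosen leaf. -/
theorem treeLaw_searchOrder_independent {V : Type*} [Fintype V] [DecidableEq V]
    (η : Measure (J × J)) [IsProbabilityMeasure η]
    (hsym : η.map Prod.swap = η)
    (P : Kernel J J) [IsMarkovKernel P]
    (hP : ∀ A B : Set J, MeasurableSet A → MeasurableSet B →
      η (A ×ˢ B) = ∫⁻ x in A, P x B ∂(η.map Prod.fst))
    (G : SimpleGraph V) (hG : G.IsTree)
    {n₁ n₂ : ℕ} (e₁ : Fin n₁ ≃ V) (par₁ : Fin n₁ → Fin n₁)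
    (e₂ : Fin n₂ ≃ V) (par₂ : Fin n₂ → Fin n₂)
    (h₁ : IsSearchOrder G e₁ par₁) (h₂ : IsSearchOrder G e₂ par₂) :
    treeLaw (η.map Prod.fst) P e₁ par₁ = treeLaw (η.map Prod.fst) P e₂ par₂ := by
  have : IsProbabilityMeasure (η.map Prod.fst) :=
    Measure.isProbabilityMeasure_map measurable_fst.aemeasurable
  have : Nonempty V := hG.connected.nonempty
  have : IsFiniteMeasure (treeLaw (η.map Prod.fst) P e₁ par₁) :=
    Measure.isFiniteMeasure_map _ _
  refine measure_pi_ext_of_lintegral_prod fun f hf => ?_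
  exact EliminatesTo.unique
    (fun a b ha hb => lintegral_mul_kernel_comm_of_symmetric η hsym P hP ha hb) hf
    (eliminatesTo_treeLaw G _ P e₁ par₁ h₁ hf) (eliminatesTo_treeLaw G _ P e₂ par₂ h₂ hf)
end

section
/- Let W be a 1-regular graphon on a standard Borel probability space (J,𝓑,π), let k and p be positive integers, and set f(x) := (∫_J W(x,y)^p dπ(y))^{1/p}, the L^p(π)-norm of the section W(x,·). If ∫_J f(x)^k dπ(x) < ∞, then the induced Markov space η_W is (k,p)-loose; more precisely, the function s_k(y_1,…,y_k) := ∫_J ∏_{i=1}^k W(x,y_i) dπ(x) is a version of dσ_k/dπ^k and satisfies ‖s_k‖_{L^p(π^k)} ≤ ∫_J f(x)^k dπ(x). In particular, if W ∈ L^p(π×π) then η_W is (p,p)-loose. -/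
open MeasureTheory ProbabilityTheory
open scoped ENNReal

/-- **Tonelli's theorem** for products of functions of one coordinate each. -/
theorem lintegral_pi_prod_eq_prod {α : Type*} [MeasurableSpace α] (μ : Measure α) [SigmaFinite μ]
    {n : ℕ} {g : Fin n → α → ℝ≥0∞} (hg : ∀ i, Measurable (g i)) :
    ∫⁻ y, ∏ i, g i (y i) ∂(Measure.pi fun _ : Fin n => μ) = ∏ i, ∫⁻ a, g i a ∂μ := by
  induction n with
  | zero => simp
  | succ n ih =>
    rw [← ((measurePreserving_piFinSuccAbove (fun _ : Fin (n + 1) => μ) 0).symm).lintegral_comp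
      (by fun_prop)]
    simp_rw [Fin.prod_univ_succ]
    change ∫⁻ z : α × (Fin n → α), g 0 z.1 * ∏ i, g i.succ (z.2 i)
      ∂(μ.prod (Measure.pi fun _ : Fin n => μ)) = _
    rw [lintegral_prod_mul (hg 0).aemeasurable (g := fun x : Fin n → α => ∏ i, g i.succ (x i))
      (Measurable.aemeasurable (by fun_prop)), ih fun i => hg i.succ]

/-- A finite power of a measure with density has the product density. -/
theorem pi_withDensity_eq {α : Type*} [MeasurableSpace α] (μ : Measure α) [SigmaFinite μ]
    (n : ℕ) {h : α → ℝ≥0∞} (hh : Measurable h) [SigmaFinite (μ.withDensity h)] :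
    (Measure.pi fun _ : Fin n => μ.withDensity h)
      = (Measure.pi fun _ : Fin n => μ).withDensity fun y => ∏ i, h (y i) := by
  refine Measure.pi_eq fun s hs => ?_
  have hS : MeasurableSet (Set.univ.pi s) := MeasurableSet.univ_pi hs
  rw [withDensity_apply _ hS, ← lintegral_indicator hS]
  have key : (Set.univ.pi s).indicator (fun y : Fin n → α => ∏ i, h (y i))
      = fun y => ∏ i, (s i).indicator h (y i) := by
    funext y
    by_cases hy : y ∈ Set.univ.pi s
    · rw [Set.indicator_of_mem hy]
      exact Finset.prod_congr rfl fun i _ => (Set.indicator_of_mem (hy i trivial) h).symm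
    · rw [Set.indicator_of_notMem hy]
      obtain ⟨i, hi⟩ : ∃ i, y i ∉ s i := by simpa [Set.mem_pi] using hy
      exact (Finset.prod_eq_zero (Finset.mem_univ i) (Set.indicator_of_notMem hi h)).symm
  rw [key, lintegral_pi_prod_eq_prod μ fun i => hh.indicator (hs i)]
  exact Finset.prod_congr rfl fun i _ => by
    rw [lintegral_indicator (hs i), withDensity_apply _ (hs i)]

/-- Averaging measures with a jointly measurable family of densities averages the densities. -/
theorem bind_withDensity_eq {α β : Type*} [MeasurableSpace α] [MeasurableSpace β]
    (μ : Measure α) (ν : Measure β) [SFinite μ] [SFinite ν] {g : α → β → ℝ≥0∞}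
    (hg : Measurable (Function.uncurry g)) :
    (μ.bind fun x => ν.withDensity (g x)) = ν.withDensity fun y => ∫⁻ x, g x y ∂μ := by
  have hmeas : Measurable fun x => ν.withDensity (g x) := by
    refine Measure.measurable_of_measurable_coe _ fun s hs => ?_
    simp_rw [withDensity_apply _ hs]
    exact hg.lintegral_prod_right'
  ext s hs
  rw [Measure.bind_apply hs hmeas.aemeasurable, withDensity_apply _ hs]
  simp_rw [withDensity_apply _ hs]
  exact lintegral_lintegral_swap hg.aemeasurable

/-- **Minkowski's integral inequality** for natural exponents. -/
theorem lintegral_lintegral_pow_le {α β : Type*} [MeasurableSpace α] [MeasurableSpace β]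
    (μ : Measure α) (ν : Measure β) [SigmaFinite μ] [SFinite ν] {g : α → β → ℝ≥0∞}
    (hg : Measurable (Function.uncurry g)) {p : ℕ} (hp : 1 ≤ p) :
    (∫⁻ y, (∫⁻ x, g x y ∂μ) ^ p ∂ν) ^ (1 / (p : ℝ))
      ≤ ∫⁻ x, (∫⁻ y, g x y ^ p ∂ν) ^ (1 / (p : ℝ)) ∂μ := by
  have hp0 : (p : ℝ) ≠ 0 := by positivity
  have hroot : ∀ a : ℝ≥0∞, (a ^ p) ^ (1 / (p : ℝ)) = a := fun a => by
    rw [← ENNReal.rpow_natCast, ← ENNReal.rpow_mul, mul_one_div_cancel hp0, ENNReal.rpow_one]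
  have hgx : ∀ x, Measurable (g x) := fun x => hg.comp measurable_prodMk_left
  have hgy : ∀ y, Measurable fun x => g x y := fun y => hg.comp measurable_prodMk_right
  have hnorm : Measurable fun x => (∫⁻ y, g x y ^ p ∂ν) ^ (1 / (p : ℝ)) :=
    (Measurable.lintegral_prod_right' (f := fun q : α × β => g q.1 q.2 ^ p)
      (hg.pow_const p)).pow_const _
  suffices h : ∫⁻ y, (∫⁻ x, g x y ∂μ) ^ p ∂ν
      ≤ (∫⁻ x, (∫⁻ y, g x y ^ p ∂ν) ^ (1 / (p : ℝ)) ∂μ) ^ p by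
    calc _ ≤ _ := ENNReal.rpow_le_rpow h (by positivity)
      _ = _ := hroot _
  have hprod : Measurable (Function.uncurry fun (y : β) (x : Fin p → α) => ∏ j, g (x j) y) := by
    refine Finset.measurable_prod _ fun j _ => ?_
    have hj : Measurable fun q : β × (Fin p → α) => (q.2 j, q.1) :=
      ((measurable_pi_apply j).comp measurable_snd).prodMk measurable_fst
    exact hg.comp hj
  calc ∫⁻ y, (∫⁻ x, g x y ∂μ) ^ p ∂ν
      = ∫⁻ y, ∫⁻ x, ∏ j, g (x j) y ∂(Measure.pi fun _ : Fin p => μ) ∂ν := by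
        refine lintegral_congr fun y => ?_
        rw [lintegral_pi_prod_eq_prod μ (g := fun _ x => g x y) fun _ => hgy y]
        simp
    _ = ∫⁻ x, ∫⁻ y, ∏ j, g (x j) y ∂ν ∂(Measure.pi fun _ : Fin p => μ) :=
        lintegral_lintegral_swap hprod.aemeasurable
    _ ≤ ∫⁻ x, ∏ j, (∫⁻ y, g (x j) y ^ p ∂ν) ^ (1 / (p : ℝ))
          ∂(Measure.pi fun _ : Fin p => μ) := by
        refine lintegral_mono fun x => ?_
        have := ENNReal.lintegral_prod_norm_pow_le (μ := ν) (Finset.univ : Finset (Fin p))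
          (f := fun j y => g (x j) y ^ p) (p := fun _ => 1 / (p : ℝ))
          (fun j _ => ((hgx (x j)).pow_const p).aemeasurable)
          (by simp [hp0]) (fun _ _ => by positivity)
        simpa only [hroot] using this
    _ = (∫⁻ x, (∫⁻ y, g x y ^ p ∂ν) ^ (1 / (p : ℝ)) ∂μ) ^ p := by
        rw [lintegral_pi_prod_eq_prod μ
          (g := fun _ x => (∫⁻ y, g x y ^ p ∂ν) ^ (1 / (p : ℝ))) fun _ => hnorm]
        simp

/-- The product `∏ i, W x (y i)` is jointly measurable in `x` and `y`. -/
theorem measurable_uncurry_prod_section {α β : Type*} [MeasurableSpace α] [MeasurableSpace β]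
    {W : α → β → ℝ≥0∞} (hW : Measurable (Function.uncurry W)) (n : ℕ) :
    Measurable (Function.uncurry fun (x : α) (y : Fin n → β) => ∏ i, W x (y i)) := by
  refine Finset.measurable_prod _ fun i _ => ?_
  exact hW.comp (measurable_fst.prodMk ((measurable_pi_apply i).comp measurable_snd))

/-- The law of `n` independent steps from a common random starting point has the density
`y ↦ ∫ ∏ i, W x (y i)`. -/
theorem bind_pi_withDensity_eq {α β : Type*} [MeasurableSpace α] [MeasurableSpace β]
    (μ : Measure α) (ν : Measure β) [SFinite μ] [SigmaFinite ν] {W : α → β → ℝ≥0∞}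
    (hW : Measurable (Function.uncurry W)) (hreg : ∀ᵐ x ∂μ, ∫⁻ y, W x y ∂ν = 1) (n : ℕ) :
    (μ.bind fun x => Measure.pi fun _ : Fin n => ν.withDensity (W x))
      = (Measure.pi fun _ : Fin n => ν).withDensity fun y => ∫⁻ x, ∏ i, W x (y i) ∂μ := by
  rw [← bind_withDensity_eq μ _ (measurable_uncurry_prod_section hW n)]
  refine Measure.bind_congr_right ?_
  filter_upwards [hreg] with x hx
  have : IsFiniteMeasure (ν.withDensity (W x)) := isFiniteMeasure_withDensity (by simp [hx])
  exact pi_withDensity_eq ν n (hW.comp measurable_prodMk_left)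

/-- The `L^p` norm of `y ↦ ∫ ∏ i, W x (y i)` is at most the integral of the `n`-th power of the
`L^p` norm of the section `W x`. -/
theorem lintegral_prod_section_pow_le {α β : Type*} [MeasurableSpace α] [MeasurableSpace β]
    (μ : Measure α) (ν : Measure β) [SigmaFinite μ] [SigmaFinite ν] {W : α → β → ℝ≥0∞}
    (hW : Measurable (Function.uncurry W)) (n : ℕ) {p : ℕ} (hp : 1 ≤ p) :
    (∫⁻ y, (∫⁻ x, ∏ i : Fin n, W x (y i) ∂μ) ^ p ∂(Measure.pi fun _ : Fin n => ν))
        ^ (1 / (p : ℝ))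
      ≤ ∫⁻ x, ((∫⁻ y, W x y ^ p ∂ν) ^ (1 / (p : ℝ))) ^ n ∂μ := by
  refine (lintegral_lintegral_pow_le μ _ (measurable_uncurry_prod_section hW n) hp).trans_eq ?_
  refine lintegral_congr fun x => ?_
  simp_rw [← Finset.prod_pow]
  rw [lintegral_pi_prod_eq_prod ν (g := fun _ a => W x a ^ p)
    fun _ => (hW.comp measurable_prodMk_left).pow_const p]
  rw [Finset.prod_const, Finset.card_univ, Fintype.card_fin, ← ENNReal.rpow_natCast,
    ← ENNReal.rpow_natCast, ← ENNReal.rpow_mul, ← ENNReal.rpow_mul, mul_comm]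

/-- **Lemma (`(k,p)`-looseness of graphon Markov spaces).**
Let `W` be a `1`-regular graphon on a probability space `(J, π)`, inducing the Markov space
`η_W = W ⬝ (π × π)` with kernel `P_x = W(x,·) ⬝ π`, and let `k, p ≥ 1`.  Set
`f(x) = (∫ W(x,y)^p dπ(y))^{1/p}`, the `L^p(π)`-norm of the section `W(x,·)`.  If
`∫ f^k dπ < ∞`, then `η_W` is `(k,p)`-loose; more precisely, the explicit function
`s_k(y) = ∫ ∏_i W(x, y_i) dπ(x)` is a version of `dσ_k/dπ^k` (i.e. `σ_k = s_k ⬝ π^k`),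
it satisfies `‖s_k‖_{L^p(π^k)} ≤ ∫ f^k dπ`, and in particular `‖s_k‖_{L^p(π^k)} < ∞`.
In particular, if `W ∈ L^p(π × π)` then `η_W` is `(p,p)`-loose. -/
theorem graphon_kploose {J : Type*} [MeasurableSpace J]
    (π : Measure J) [IsProbabilityMeasure π]
    (W : J → J → ℝ≥0∞) (hWmeas : Measurable (Function.uncurry W))
    (hWsym : ∀ x y, W x y = W y x)
    (hWreg : ∀ᵐ x ∂π, ∫⁻ y, W x y ∂π = 1)
    (k p : ℕ) (hk : 1 ≤ k) (hp : 1 ≤ p)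
    (f : J → ℝ≥0∞) (hf : f = fun x => (∫⁻ y, W x y ^ p ∂π) ^ (1 / (p : ℝ)))
    (hfk : ∫⁻ x, f x ^ k ∂π < ⊤) :
    ((π.bind fun x => Measure.pi fun _ : Fin k => π.withDensity (W x))
        ≪ Measure.pi fun _ : Fin k => π) ∧
    ((π.bind fun x => Measure.pi fun _ : Fin k => π.withDensity (W x))
        = (Measure.pi fun _ : Fin k => π).withDensity
            fun y => ∫⁻ x, ∏ i : Fin k, W x (y i) ∂π) ∧
    ((∫⁻ y, (∫⁻ x, ∏ i : Fin k, W x (y i) ∂π) ^ p ∂(Measure.pi fun _ : Fin k => π))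
        ^ (1 / (p : ℝ)) ≤ ∫⁻ x, f x ^ k ∂π) ∧
    (∫⁻ y, (∫⁻ x, ∏ i : Fin k, W x (y i) ∂π) ^ p ∂(Measure.pi fun _ : Fin k => π) < ⊤) ∧
    ((∫⁻ q : J × J, W q.1 q.2 ^ p ∂(π.prod π)) < ⊤ →
      ((π.bind fun x => Measure.pi fun _ : Fin p => π.withDensity (W x))
          ≪ Measure.pi fun _ : Fin p => π) ∧
      ∫⁻ y, (∫⁻ x, ∏ i : Fin p, W x (y i) ∂π) ^ p ∂(Measure.pi fun _ : Fin p => π) < ⊤) := by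
  have hp0 : (0 : ℝ) < p := by positivity
  have hac : ∀ n : ℕ, (π.bind fun x => Measure.pi fun _ : Fin n => π.withDensity (W x))
      ≪ Measure.pi fun _ : Fin n => π := fun n => by
    rw [bind_pi_withDensity_eq π π hWmeas hWreg n]
    exact withDensity_absolutelyContinuous _ _
  have hfin : ∀ n : ℕ, ∫⁻ x, ((∫⁻ y, W x y ^ p ∂π) ^ (1 / (p : ℝ))) ^ n ∂π < ⊤ →
      ∫⁻ y, (∫⁻ x, ∏ i : Fin n, W x (y i) ∂π) ^ p ∂(Measure.pi fun _ : Fin n => π) < ⊤ :=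
    fun n h => (ENNReal.rpow_lt_top_iff_of_pos (by positivity)).1
      ((lintegral_prod_section_pow_le π π hWmeas n hp).trans_lt h)
  subst hf
  refine ⟨hac k, bind_pi_withDensity_eq π π hWmeas hWreg k,
    lintegral_prod_section_pow_le π π hWmeas k hp, hfin k hfk, fun hLp => ⟨hac p, hfin p ?_⟩⟩
  rw [lintegral_prod (fun q : J × J => W q.1 q.2 ^ p) (hWmeas.pow_const p).aemeasurable] at hLp
  refine lt_of_eq_of_lt (lintegral_congr fun x => ?_) hLp
  rw [← ENNReal.rpow_natCast, ← ENNReal.rpow_mul, one_div_mul_cancel hp0.ne', ENNReal.rpow_one]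
end

section
/- Let G=(V,E) be a finite triangle-free simple graph with |V|=n, let X be any set, and let F be a function assigning an element of X to every ordering p=(v_1,…,v_n) of V (i.e., to every bijection {1,…,n}→V). Assume F satisfies: (i) if v_k and v_{k+1} are nonadjacent in G, then interchanging v_k and v_{k+1} in p does not change F(p); (ii) if every vertex of the block A={v_1,…,v_a} is adjacent in G to every vertex of the block B={v_{a+1},…,v_{a+b}}, then interchanging the two blocks (so the ordering begins v_{a+1},…,v_{a+b},v_1,…,v_a, with the remainder unchanged) does not change F(p). Then F is constant on all orderings of V. -/
/-- Two orderings that agree from position `m` on have the same vertices before position `m`. -/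
lemma symm_lt_of_agree_from {V : Type*} {n m : ℕ} {p r : Fin n ≃ V}
    (h : ∀ i : Fin n, m ≤ (i : ℕ) → r i = p i) {i : Fin n} (hi : (i : ℕ) < m) :
    (r.symm (p i) : ℕ) < m := by
  by_contra! hlt
  have h3 := h _ hlt
  rw [Equiv.apply_symm_apply] at h3
  rw [← p.injective h3] at hlt
  omega

/-- The permutation of positions that moves the `b` positions following the first `a` ones to the
front. -/
def blockSwap (n a b : ℕ) (hab : a + b ≤ n) : Equiv.Perm (Fin n) where
  toFun i := ⟨if (i : ℕ) < b then i + a else if (i : ℕ) < a + b then i - b else i, by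
    split_ifs <;> omega⟩
  invFun i := ⟨if (i : ℕ) < a then i + b else if (i : ℕ) < a + b then i - a else i, by
    split_ifs <;> omega⟩
  left_inv i := by
    ext
    dsimp only
    split_ifs <;> omega
  right_inv i := by
    ext
    dsimp only
    split_ifs <;> omega

/-- The vertices in the first `m` positions of an ordering can be rearranged so that those in `C`
come first. -/
lemma exists_agree_from_with_prefix {V : Type*} {n m : ℕ} (p : Fin n ≃ V) (C : Set V) :
    ∃ (r : Fin n ≃ V) (a : ℕ), (∀ i : Fin n, m ≤ (i : ℕ) → r i = p i) ∧ a ≤ m ∧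
      (∀ i : Fin n, (i : ℕ) < a → r i ∈ C) ∧
      ∀ i : Fin n, a ≤ (i : ℕ) → (i : ℕ) < m → r i ∉ C := by
  classical
  let P : ℕ → Prop := fun a => ∃ r : Fin n ≃ V, (∀ i : Fin n, m ≤ (i : ℕ) → r i = p i) ∧
    ∀ i : Fin n, (i : ℕ) < a → r i ∈ C
  have hP : P (Nat.findGreatest P m) :=
    Nat.findGreatest_spec (Nat.zero_le m) ⟨p, fun _ _ => rfl, fun _ h => by omega⟩
  have hle : Nat.findGreatest P m ≤ m := Nat.findGreatest_le m
  have hmax : ∀ a, Nat.findGreatest P m < a → a ≤ m → ¬ P a :=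
    fun a => Nat.findGreatest_is_greatest
  generalize Nat.findGreatest P m = a at hP hle hmax
  obtain ⟨r, hr, hrC⟩ := hP
  refine ⟨r, a, hr, hle, hrC, fun j haj hjm hjC => ?_⟩
  let a' : Fin n := ⟨a, by omega⟩
  refine hmax (a + 1) (by omega) (by omega) ⟨(Equiv.swap a' j).trans r, fun i hi => ?_,
    fun i hi => ?_⟩
  · rw [Equiv.trans_apply, Equiv.swap_apply_of_ne_of_ne, hr i hi]
    · rintro rfl
      simp only [a'] at hi
      omega
    · rintro rfl
      omega
  · rcases eq_or_ne i a' with rfl | hia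
    · simpa using hjC
    · have hlt : (i : ℕ) < a := by
        have : (i : ℕ) ≠ a := fun h => hia (Fin.ext h)
        omega
      rw [Equiv.trans_apply, Equiv.swap_apply_of_ne_of_ne hia]
      · exact hrC i hlt
      · rintro rfl
        omega


/-- **Reordering lemma for triangle-free graphs.**
Let `G` be a finite triangle-free simple graph on `V`, with `|V| = n`, and let `F` assign
an element of a set `X` to each ordering of `V` (a bijection `Fin n ≃ V`).  If `F` is invariant
under (i) interchanging two consecutive nonadjacent vertices, and (ii) interchanging an initial
block `A` of size `a` with the following block `B` of size `b` whenever every vertex of `A` is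
adjacent to every vertex of `B`, then `F` is constant. -/
theorem reorder_invariant_constant {V : Type*} [Fintype V] [DecidableEq V]
    (G : SimpleGraph V) (hG : G.CliqueFree 3) {X : Type*} (n : ℕ)
    (hn : Fintype.card V = n) (F : (Fin n ≃ V) → X)
    (h1 : ∀ (p : Fin n ≃ V) (k k' : Fin n), (k : ℕ) + 1 = (k' : ℕ) →
      ¬ G.Adj (p k) (p k') → F ((Equiv.swap k k').trans p) = F p)
    (h2 : ∀ (p q : Fin n ≃ V) (a b : ℕ) (hab : a + b ≤ n),
      (∀ i j : Fin n, (i : ℕ) < a → a ≤ (j : ℕ) → (j : ℕ) < a + b → G.Adj (p i) (p j)) →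
      (∀ (i : Fin n) (hi : (i : ℕ) < b), q i = p ⟨(i : ℕ) + a, by omega⟩) →
      (∀ (i : Fin n) (hi1 : b ≤ (i : ℕ)) (hi2 : (i : ℕ) < a + b), q i = p ⟨(i : ℕ) - b, by omega⟩) →
      (∀ i : Fin n, a + b ≤ (i : ℕ) → q i = p i) →
      F q = F p) :
    ∀ p q : Fin n ≃ V, F p = F q := by
  suffices H : ∀ m : ℕ, m ≤ n → ∀ p q : Fin n ≃ V, (∀ i : Fin n, m ≤ (i : ℕ) → q i = p i) →
      F q = F p from fun p q => H n le_rfl q p fun i hi => absurd i.isLt (by omega)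
  intro m
  induction m with
  | zero => exact fun _ p q h => congrArg F (Equiv.ext fun i => h i (Nat.zero_le _))
  | succ k ih =>
    intro hk p q hpq
    have ih := ih (by omega)
    let l : Fin n := ⟨k, by omega⟩
    by_contra hne
    -- The vertices that stand at position `k` in an ordering equivalent to `p`.
    let C : Set V := {v | ∃ r : Fin n ≃ V, (∀ i : Fin n, k + 1 ≤ (i : ℕ) → r i = p i) ∧
      r l = v ∧ F r = F p}
    have hC : ∀ r : Fin n ≃ V, (∀ i : Fin n, k + 1 ≤ (i : ℕ) → r i = p i) →
        r l ∈ C → F r = F p := by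
      rintro r hr ⟨s, hs, hsl, hsF⟩
      rw [← hsF]
      refine ih s r fun i hi => ?_
      rcases eq_or_ne i l with rfl | hil
      · exact hsl.symm
      · have : (i : ℕ) ≠ k := fun h => hil (Fin.ext h)
        rw [hr i (by omega), hs i (by omega)]
    have hpC : p l ∈ C := ⟨p, fun _ _ => rfl, rfl, rfl⟩
    have hqC : q l ∉ C := fun h => hne (hC q hpq h)
    have hadj : ∀ u ∈ C, ∀ i : Fin n, (i : ℕ) < k + 1 → p i ∉ C → G.Adj u (p i) := by
      rintro u ⟨r, hr, rfl, hrF⟩ i hi hiC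
      by_contra hnadj
      have hjlt := symm_lt_of_agree_from hr hi
      obtain ⟨j, hj⟩ : ∃ j, r.symm (p i) = j := ⟨_, rfl⟩
      rw [hj] at hjlt
      rw [Equiv.symm_apply_eq] at hj
      rw [hj] at hiC hnadj
      have hjl : j ≠ l := by
        rintro rfl
        exact hiC ⟨r, hr, rfl, hrF⟩
      have hjk : (j : ℕ) < k := by
        have : (j : ℕ) ≠ k := fun h => hjl (Fin.ext h)
        omega
      let l' : Fin n := ⟨k - 1, by omega⟩
      have hll' : l ≠ l' := fun h => by
        have := congrArg Fin.val h
        simp only [l, l'] at this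
        omega
      let s := (Equiv.swap j l').trans r
      have hs : ∀ i : Fin n, k ≤ (i : ℕ) → s i = r i := fun i hi => by
        simp only [s, Equiv.trans_apply]
        rw [Equiv.swap_apply_of_ne_of_ne]
        · rintro rfl
          omega
        · rintro rfl
          simp only [l'] at hi
          omega
      have hsl' : s l' = r j := by simp [s]
      have hsl : s l = r l := hs l le_rfl
      refine hiC ⟨(Equiv.swap l' l).trans s, fun i hi => ?_, by simp [hsl'], ?_⟩
      · rw [Equiv.trans_apply, Equiv.swap_apply_of_ne_of_ne, hs i (by omega), hr i hi]
        · rintro rfl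
          simp only [l'] at hi
          omega
        · rintro rfl
          simp only [l] at hi
          omega
      · rw [h1 s l' l (by simp only [l, l']; omega), ih r s hs, hrF]
        rw [hsl', hsl]
        exact fun h => hnadj h.symm
    obtain ⟨r, a, hr, hak, hrC, hrB⟩ := exists_agree_from_with_prefix (m := k + 1) p C
    have ha0 : 0 < a := by
      by_contra! h
      have hlt := symm_lt_of_agree_from hr (i := l) (Nat.lt_succ_self k)
      exact hrB _ (by omega) hlt (by simpa using hpC)
    have hak' : a ≤ k := by
      by_contra! h
      have hrq : ∀ i : Fin n, k + 1 ≤ (i : ℕ) → r i = q i := fun i hi => by rw [hr i hi, hpq i hi]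
      have hlt := symm_lt_of_agree_from hrq (i := l) (Nat.lt_succ_self k)
      exact hqC (by simpa using hrC (r.symm (q l)) (by omega))
    have hab : a + (k + 1 - a) ≤ n := by omega
    let s := (blockSwap n a (k + 1 - a) hab).trans r
    have hs : ∀ i : Fin n, k + 1 ≤ (i : ℕ) → s i = r i := fun i hi => by
      refine congrArg r (Fin.ext ?_)
      simp only [blockSwap, Equiv.coe_fn_mk]
      split_ifs <;> omega
    have hsr : F s = F r := by
      refine h2 r s a (k + 1 - a) hab (fun i j hi haj hj => ?_) (fun i hi => ?_)
        (fun i hi hi' => ?_) fun i hi => hs i (by omega)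
      · have hrB' := hrB j haj (by omega)
        have hlt := symm_lt_of_agree_from (fun i hi => (hr i hi).symm) (i := j)
          (show (j : ℕ) < k + 1 by omega)
        simpa using hadj (r i) (hrC i hi) (p.symm (r j)) hlt (by simpa using hrB')
      · refine congrArg r (Fin.ext ?_)
        simp [blockSwap, hi]
      · refine congrArg r (Fin.ext ?_)
        simp only [blockSwap, Equiv.coe_fn_mk]
        split_ifs <;> omega
    have hsl : s l ∈ C := by
      refine hrC _ ?_
      simp only [blockSwap, Equiv.coe_fn_mk, l]
      split_ifs <;> omega
    have hsF := hC s (fun i hi => (hs i hi).trans (hr i hi)) hsl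
    exact hrB l hak' (Nat.lt_succ_self k) ⟨r, hr, rfl, hsr ▸ hsF⟩
end
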